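/- arXiv:1703.10942 — 5 statements merged into one kernel-verified Lean document; each statement's English description precedes it below -/
import Mathlib

section
/- Let k be an algebraically closed field of characteristic p > 0 dividing the order of a finite group G. Let M and N be finite-dimensional indecomposable kG-modules whose dimensions are prime to p, let f: M → N be a kG-linear map, and let X be a finite-dimensional kG-module. Suppose U is a finite-dimensional indecomposable kG-module of dimension prime to p together with a split kG-monomorphism i: U → M ⊗ X and a split kG-epimorphism q: N ⊗ X → U, and suppose the composite q∘(f ⊗ id_X)∘i: U → U is an isomorphism. Then f: M → N is an isomorphism. -/
open TensorProduct

section Defs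

variable {k G : Type} [Field k] [Group G]

/-- A `kG`-linear map between two representations of `G` over `k`:
a `k`-linear map commuting with the `G`-actions. -/
def Equivariant {V W : Type} [AddCommGroup V] [Module k V] [AddCommGroup W] [Module k W]
    (ρV : Representation k G V) (ρW : Representation k G W) (f : V →ₗ[k] W) : Prop :=
  ∀ g : G, f ∘ₗ ρV g = ρW g ∘ₗ f

/-- A submodule is a subrepresentation if it is stable under the `G`-action. -/
def IsSubrep {V : Type} [AddCommGroup V] [Module k V] (ρ : Representation k G V)
    (p : Submodule k V) : Prop := ∀ g : G, ∀ x ∈ p, ρ g x ∈ p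

/-- A representation is indecomposable if it is nonzero and not the direct sum of
two nonzero subrepresentations. -/
def IndecomposableRep {V : Type} [AddCommGroup V] [Module k V]
    (ρ : Representation k G V) : Prop :=
  Nontrivial V ∧ ¬ ∃ p q : Submodule k V,
    IsSubrep ρ p ∧ IsSubrep ρ q ∧ IsCompl p q ∧ p ≠ ⊥ ∧ q ≠ ⊥

end Defs

section PartialTrace

variable {k M N X : Type} [Field k]
  [AddCommGroup M] [Module k M]
  [AddCommGroup N] [Module k N] [FiniteDimensional k N]
  [AddCommGroup X] [Module k X] [FiniteDimensional k X]

/-- The partial trace over `X` of a linear map `N ⊗ X → M ⊗ X`. -/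
noncomputable def partialTrace : (N ⊗[k] X →ₗ[k] M ⊗[k] X) →ₗ[k] (N →ₗ[k] M) :=
  (TensorProduct.rid k (N →ₗ[k] M)).toLinearMap ∘ₗ
    (LinearMap.trace k X).lTensor (N →ₗ[k] M) ∘ₗ
    (homTensorHomEquiv k N X M X).symm.toLinearMap

theorem partialTrace_map (u : N →ₗ[k] M) (v : X →ₗ[k] X) :
    partialTrace (TensorProduct.map u v) = LinearMap.trace k X v • u := by
  have h : TensorProduct.map u v = homTensorHomEquiv k N X M X (u ⊗ₜ v) := by
    simp [homTensorHomEquiv_apply]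
  simp only [partialTrace, h, LinearMap.comp_apply, LinearEquiv.coe_coe,
    LinearEquiv.symm_apply_apply, LinearMap.lTensor_tmul, TensorProduct.rid_tmul]

theorem hom_tensor_induction {P : (N ⊗[k] X →ₗ[k] M ⊗[k] X) → Prop}
    (a : N ⊗[k] X →ₗ[k] M ⊗[k] X) (zero : P 0)
    (map : ∀ (u : N →ₗ[k] M) (v : X →ₗ[k] X), P (TensorProduct.map u v))
    (add : ∀ a b, P a → P b → P (a + b)) : P a := by
  obtain ⟨t, rfl⟩ := (homTensorHomEquiv k N X M X).surjective a
  induction t using TensorProduct.induction_on with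
  | zero => simpa using zero
  | tmul u v => simpa [homTensorHomEquiv_apply] using map u v
  | add s t hs ht => simpa only [map_add] using add _ _ hs ht

theorem partialTrace_conj (A : M →ₗ[k] M) (C : N →ₗ[k] N) (B D : X →ₗ[k] X)
    (hDB : D ∘ₗ B = LinearMap.id) (a : N ⊗[k] X →ₗ[k] M ⊗[k] X) :
    partialTrace (TensorProduct.map A B ∘ₗ a ∘ₗ TensorProduct.map C D) =
      A ∘ₗ partialTrace a ∘ₗ C := by
  induction a using hom_tensor_induction with
  | zero => simp
  | map u v =>
    have h : LinearMap.trace k X (B ∘ₗ v ∘ₗ D) = LinearMap.trace k X v := by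
      rw [LinearMap.trace_comp_comm', LinearMap.comp_assoc, hDB, LinearMap.comp_id]
    rw [← TensorProduct.map_comp, ← TensorProduct.map_comp, partialTrace_map,
      partialTrace_map, h, LinearMap.smul_comp, LinearMap.comp_smul]
  | add a b ha hb =>
    simp only [LinearMap.add_comp, LinearMap.comp_add, map_add, ha, hb]

theorem trace_comp_rTensor [FiniteDimensional k M] (f : M →ₗ[k] N) (a : N ⊗[k] X →ₗ[k] M ⊗[k] X) :
    LinearMap.trace k (M ⊗[k] X) (a ∘ₗ f.rTensor X) =
      LinearMap.trace k M (partialTrace a ∘ₗ f) := by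
  induction a using hom_tensor_induction with
  | zero => simp
  | map u v =>
    rw [LinearMap.rTensor, ← TensorProduct.map_comp, LinearMap.comp_id, partialTrace_map,
      LinearMap.trace_tensorProduct', LinearMap.smul_comp, map_smul, smul_eq_mul, mul_comm]
  | add a b ha hb =>
    simp only [LinearMap.add_comp, map_add, ha, hb]

theorem Equivariant.partialTrace {G : Type} [Group G] {ρM : Representation k G M}
    {ρN : Representation k G N} {ρX : Representation k G X}
    {a : N ⊗[k] X →ₗ[k] M ⊗[k] X} (ha : Equivariant (ρN.tprod ρX) (ρM.tprod ρX) a) :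
    Equivariant ρN ρM (partialTrace a) := by
  intro g
  have hX : ρX g⁻¹ ∘ₗ ρX g = LinearMap.id := by
    rw [← Module.End.mul_eq_comp, ← map_mul, inv_mul_cancel, map_one, Module.End.one_eq_id]
  have hN : ρN g⁻¹ ∘ₗ ρN g = LinearMap.id := by
    rw [← Module.End.mul_eq_comp, ← map_mul, inv_mul_cancel, map_one, Module.End.one_eq_id]
  have hT : ρN.tprod ρX g ∘ₗ ρN.tprod ρX g⁻¹ = LinearMap.id := by
    rw [← Module.End.mul_eq_comp, ← map_mul, mul_inv_cancel, map_one, Module.End.one_eq_id]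
  have hconj : ρM.tprod ρX g ∘ₗ a ∘ₗ ρN.tprod ρX g⁻¹ = a := by
    rw [← LinearMap.comp_assoc, ← ha g, LinearMap.comp_assoc, hT, LinearMap.comp_id]
  have h := partialTrace_conj (ρM g) (ρN g⁻¹) (ρX g) (ρX g⁻¹) hX a
  rw [← Representation.tprod_apply, ← Representation.tprod_apply, hconj] at h
  conv_lhs => rw [h]
  rw [LinearMap.comp_assoc, LinearMap.comp_assoc, hN, LinearMap.comp_id]

end PartialTrace

section Equivariant

variable {k G : Type} [Field k] [Group G] {V W Z : Type}
  [AddCommGroup V] [Module k V] [AddCommGroup W] [Module k W] [AddCommGroup Z] [Module k Z]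
  {ρV : Representation k G V} {ρW : Representation k G W} {ρZ : Representation k G Z}

theorem Equivariant.apply {f : V →ₗ[k] W} (hf : Equivariant ρV ρW f) (g : G) (x : V) :
    f (ρV g x) = ρW g (f x) :=
  LinearMap.congr_fun (hf g) x

theorem Equivariant.comp {h : W →ₗ[k] Z} {f : V →ₗ[k] W} (hh : Equivariant ρW ρZ h)
    (hf : Equivariant ρV ρW f) : Equivariant ρV ρZ (h ∘ₗ f) := by
  intro g
  ext x
  simp [hf.apply, hh.apply]

theorem Equivariant.symm {e : V ≃ₗ[k] W} (he : Equivariant ρV ρW e.toLinearMap) :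
    Equivariant ρW ρV e.symm.toLinearMap := by
  intro g
  ext x
  have h := he.apply g (e.symm x)
  apply e.injective
  simpa using h.symm

theorem Equivariant.rTensor {X : Type} [AddCommGroup X] [Module k X]
    {ρX : Representation k G X} {f : V →ₗ[k] W} (hf : Equivariant ρV ρW f) :
    Equivariant (ρV.tprod ρX) (ρW.tprod ρX) (f.rTensor X) := by
  intro g
  ext v x
  simp [hf.apply]

theorem Equivariant.pow {f : V →ₗ[k] V} (hf : Equivariant ρV ρV f) (n : ℕ) :
    Equivariant ρV ρV (f ^ n) := by
  induction n with
  | zero => intro g; ext x; simp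
  | succ n ih => rw [pow_succ]; exact Equivariant.comp ih hf

theorem Equivariant.isSubrep_ker {f : V →ₗ[k] W} (hf : Equivariant ρV ρW f) :
    IsSubrep ρV (LinearMap.ker f) := by
  intro g x hx
  rw [LinearMap.mem_ker] at hx ⊢
  rw [hf.apply, hx, map_zero]

theorem Equivariant.isSubrep_range {f : V →ₗ[k] W} (hf : Equivariant ρV ρW f) :
    IsSubrep ρW (LinearMap.range f) := by
  rintro g _ ⟨x, rfl⟩
  exact ⟨ρV g x, hf.apply g x⟩

/-- Fitting's lemma: an equivariant endomorphism of nonzero trace of an indecomposable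
representation is bijective. -/
theorem IndecomposableRep.bijective_of_trace_ne_zero [FiniteDimensional k V]
    (hV : IndecomposableRep ρV) {f : V →ₗ[k] V} (hf : Equivariant ρV ρV f)
    (htr : LinearMap.trace k V f ≠ 0) : Function.Bijective f := by
  obtain ⟨n, hn, hcompl⟩ :=
    ((Filter.eventually_ge_atTop 1).and f.eventually_isCompl_ker_pow_range_pow).exists
  have hker : LinearMap.ker (f ^ n) = ⊥ := by
    by_contra hker
    refine hV.2 ⟨_, _, (hf.pow n).isSubrep_ker, (hf.pow n).isSubrep_range, hcompl, hker, ?_⟩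
    intro hrange
    have hnil : IsNilpotent f := ⟨n, LinearMap.range_eq_bot.1 hrange⟩
    exact htr (LinearMap.isNilpotent_trace_of_isNilpotent hnil).eq_zero
  have hinj : Function.Injective f := by
    rw [← LinearMap.ker_eq_bot, eq_bot_iff, ← hker]
    intro x hx
    obtain ⟨m, rfl⟩ := Nat.exists_eq_add_of_le' hn
    rw [LinearMap.mem_ker] at hx ⊢
    rw [pow_succ, Module.End.mul_apply, hx, map_zero]
  exact ⟨hinj, LinearMap.injective_iff_surjective.1 hinj⟩

end Equivariant

/-- If `f : M → N` between indecomposables of dimension prime to `p` becomes an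
isomorphism on a common direct summand `U` (of dimension prime to `p`) of `M ⊗ X` and
`N ⊗ X`, then `f` is an isomorphism. -/
theorem map_invertible_on_common_tensor_summand_is_iso
    (p : ℕ) (hp : p.Prime) (k : Type) [Field k] [IsAlgClosed k] [CharP k p]
    (G : Type) [Group G] [Fintype G] (hG : p ∣ Fintype.card G)
    (M N X U : Type)
    [AddCommGroup M] [Module k M] [FiniteDimensional k M]
    [AddCommGroup N] [Module k N] [FiniteDimensional k N]
    [AddCommGroup X] [Module k X] [FiniteDimensional k X]
    [AddCommGroup U] [Module k U] [FiniteDimensional k U]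
    (ρM : Representation k G M) (ρN : Representation k G N)
    (ρX : Representation k G X) (ρU : Representation k G U)
    (hMind : IndecomposableRep ρM) (hNind : IndecomposableRep ρN)
    (hMdim : ¬ (p ∣ Module.finrank k M)) (hNdim : ¬ (p ∣ Module.finrank k N))
    (hUind : IndecomposableRep ρU) (hUdim : ¬ (p ∣ Module.finrank k U))
    (f : M →ₗ[k] N) (hf : Equivariant ρM ρN f)
    (i : U →ₗ[k] M ⊗[k] X) (hi : Equivariant ρU (ρM.tprod ρX) i)
    (hisplit : ∃ r : M ⊗[k] X →ₗ[k] U,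
      Equivariant (ρM.tprod ρX) ρU r ∧ r ∘ₗ i = LinearMap.id)
    (q : N ⊗[k] X →ₗ[k] U) (hq : Equivariant (ρN.tprod ρX) ρU q)
    (hqsplit : ∃ s : U →ₗ[k] N ⊗[k] X,
      Equivariant ρU (ρN.tprod ρX) s ∧ q ∘ₗ s = LinearMap.id)
    (hiso : Function.Bijective (q ∘ₗ f.rTensor X ∘ₗ i)) :
    Function.Bijective f := by
  let e : U ≃ₗ[k] U := LinearEquiv.ofBijective _ hiso
  have he : Equivariant ρU ρU e.toLinearMap := hq.comp (hf.rTensor.comp hi)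
  let a : N ⊗[k] X →ₗ[k] M ⊗[k] X := i ∘ₗ e.symm.toLinearMap ∘ₗ q
  have ha : Equivariant (ρN.tprod ρX) (ρM.tprod ρX) a := hi.comp (he.symm.comp hq)
  have hU : (Module.finrank k U : k) ≠ 0 := fun h => hUdim ((CharP.cast_eq_zero_iff k p _).1 h)
  have htr : LinearMap.trace k M (partialTrace a ∘ₗ f) ≠ 0 := by
    have hid : (e.symm.toLinearMap ∘ₗ q ∘ₗ f.rTensor X) ∘ₗ i = LinearMap.id := by
      ext x
      exact e.symm_apply_apply x
    have hcomp : a ∘ₗ f.rTensor X = i ∘ₗ (e.symm.toLinearMap ∘ₗ q ∘ₗ f.rTensor X) := rfl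
    rwa [← trace_comp_rTensor, hcomp, LinearMap.trace_comp_comm', hid, LinearMap.trace_id]
  have hMM := hMind.bijective_of_trace_ne_zero (ha.partialTrace.comp hf) htr
  have hNN := hNind.bijective_of_trace_ne_zero (hf.comp ha.partialTrace)
    (by rwa [LinearMap.trace_comp_comm'])
  rw [LinearMap.coe_comp] at hMM hNN
  exact ⟨hMM.1.of_comp, hNN.2.of_comp⟩
end

section
/- Let k be a field of characteristic p > 0 and G a finite group whose order is divisible by p. Then the Kelly radical of the category of finite-dimensional kG-modules is not a tensor ideal: there exist finite-dimensional kG-modules M, N, X and a kG-linear map f: M → N lying in the Kelly radical Rad(M, N) such that f ⊗ id_X: M ⊗ X → N ⊗ X does not lie in Rad(M ⊗ X, N ⊗ X). -/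
open TensorProduct

/-- The left regular representation on functions: `(g • φ) h = φ (g⁻¹ * h)`. -/
def functionRep (k G : Type) [Field k] [Group G] : Representation k G (G → k) where
  toFun g := LinearMap.funLeft k k (g⁻¹ * ·)
  map_one' := by ext; simp [LinearMap.funLeft_apply]
  map_mul' a b := by
    refine LinearMap.ext fun φ => funext fun h => ?_
    simp [LinearMap.funLeft_apply, mul_assoc]

theorem functionRep_apply {k G : Type} [Field k] [Group G] (g : G) (φ : G → k) (h : G) :
    functionRep k G g φ h = φ (g⁻¹ * h) := rfl

/-- An invariant functional on functions on `G` takes the value `|G| • c` at the constant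
function `1`, where `c` is its value at the indicator of the identity. -/
theorem Equivariant.map_one_eq_card_mul {k G : Type} [Field k] [Group G] [Fintype G]
    [DecidableEq G] {l : (G → k) →ₗ[k] k}
    (hl : Equivariant (functionRep k G) (Representation.trivial k G k) l) :
    l 1 = Fintype.card G * l (Pi.single 1 1) := by
  have single_eq (g : G) :
      (Pi.single g 1 : G → k) = functionRep k G g (Pi.single 1 1) := by
    ext h
    simp [functionRep_apply, Pi.single_apply, inv_mul_eq_one, eq_comm]
  have map_single (g : G) : l (Pi.single g 1) = l (Pi.single 1 1) := by
    rw [single_eq]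
    simpa using LinearMap.congr_fun (hl g) (Pi.single 1 1)
  have one_eq : (1 : G → k) = ∑ g, Pi.single g 1 :=
    (Finset.univ_sum_single (1 : G → k)).symm
  simp [one_eq, map_single]

/-- Pointwise multiplication of functions on `G`, with values in `k ⊗ (G → k)`, is equivariant. -/
theorem equivariant_lid_symm_comp_mul' {k G : Type} [Field k] [Group G] :
    Equivariant ((functionRep k G).tprod (functionRep k G))
      ((Representation.trivial k G k).tprod (functionRep k G))
      ((TensorProduct.lid k (G → k)).symm.toLinearMap ∘ₗ LinearMap.mul' k (G → k)) := by
  refine fun g => TensorProduct.ext' fun φ ψ => ?_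
  simp only [LinearMap.comp_apply, Representation.tprod_apply, TensorProduct.map_tmul,
    LinearMap.mul'_apply, LinearEquiv.coe_coe, TensorProduct.lid_symm_apply]
  rfl

/-- The Kelly radical of the category of finite-dimensional `kG`-modules is never a
tensor ideal when `p` divides `|G|`: there are `M`, `N`, `X` and `f : M → N` in the
radical such that `f ⊗ id_X` is not in the radical. -/
theorem kelly_radical_of_module_category_is_not_tensor_ideal
    (p : ℕ) (hp : p.Prime) (k : Type) [Field k] [CharP k p]
    (G : Type) [Group G] [Fintype G] (hG : p ∣ Fintype.card G) :
    ∃ (M N X : Type)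
      (_ : AddCommGroup M) (_ : Module k M) (_ : FiniteDimensional k M)
      (_ : AddCommGroup N) (_ : Module k N) (_ : FiniteDimensional k N)
      (_ : AddCommGroup X) (_ : Module k X) (_ : FiniteDimensional k X)
      (ρM : Representation k G M) (ρN : Representation k G N)
      (ρX : Representation k G X) (f : M →ₗ[k] N),
      Equivariant ρM ρN f ∧
      (∀ g : N →ₗ[k] M, Equivariant ρN ρM g →
        Function.Bijective ((LinearMap.id : M →ₗ[k] M) - g ∘ₗ f)) ∧
      ¬ (∀ g : N ⊗[k] X →ₗ[k] M ⊗[k] X,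
        Equivariant (ρN.tprod ρX) (ρM.tprod ρX) g →
        Function.Bijective ((LinearMap.id : M ⊗[k] X →ₗ[k] M ⊗[k] X) - g ∘ₗ f.rTensor X)) := by
  classical
  have card_eq_zero : (Fintype.card G : k) = 0 := (CharP.cast_eq_zero_iff k p _).2 hG
  refine ⟨k, G → k, G → k, inferInstance, inferInstance, inferInstance, inferInstance,
    inferInstance, inferInstance, inferInstance, inferInstance, inferInstance,
    Representation.trivial k G k, functionRep k G, functionRep k G,
    Algebra.linearMap k (G → k), fun g => ?_, fun l hl => ?_, fun h => ?_⟩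
  · ext
    simp [functionRep_apply]
  · have comp_eq_zero : l ∘ₗ Algebra.linearMap k (G → k) = 0 := by
      ext
      simp [hl.map_one_eq_card_mul, card_eq_zero]
    rw [comp_eq_zero, sub_zero]
    exact Function.bijective_id
  · have retraction :
        ((TensorProduct.lid k (G → k)).symm.toLinearMap ∘ₗ LinearMap.mul' k (G → k)) ∘ₗ
          (Algebra.linearMap k (G → k)).rTensor (G → k) = LinearMap.id := by
      refine TensorProduct.ext' fun c φ => ?_
      simp [← Algebra.smul_def, TensorProduct.smul_tmul']
    have zero_injective := (h _ equivariant_lid_symm_comp_mul').injective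
    rw [retraction, sub_self] at zero_injective
    have one_eq_zero : (1 : k) ⊗ₜ[k] (1 : G → k) = 0 := zero_injective rfl
    exact one_ne_zero (α := G → k) (by simpa using congrArg (TensorProduct.lid k (G → k)) one_eq_zero)
end

section
/- Let k be an algebraically closed field of characteristic p > 0 and let G be a finite group whose Sylow p-subgroups have order exactly p (i.e., p divides |G| but p² does not). Then every finite-dimensional indecomposable kG-module that is not projective has k-dimension prime to p. -/
open TensorProduct

open Finset in
/-- In characteristic `p`, the sum of the powers `n ^ j` over `n < p` vanishes for `j < p - 1`. -/
theorem sum_range_natCast_pow_eq_zero {A : Type*} [Ring A] {p : ℕ} (hp : p.Prime) [CharP A p]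
    {j : ℕ} (hj : j < p - 1) : ∑ n ∈ range p, (n : A) ^ j = 0 := by
  have : Fact p.Prime := ⟨hp⟩
  have h := FiniteField.sum_pow_lt_card_sub_one (ZMod p) j (by rwa [ZMod.card])
  have hsum : ∑ n ∈ range p, (n : ZMod p) ^ j = 0 := by
    rw [← h]
    refine sum_bij' (fun n _ ↦ (n : ZMod p)) (fun a _ ↦ a.val) (by simp)
      (fun a _ ↦ by simpa using a.val_lt) (fun n hn ↦ ?_) (by simp) (by simp)
    exact ZMod.val_cast_of_lt (mem_range.mp hn)
  simpa using congrArg (ZMod.castHom dvd_rfl A) hsum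

open Finset in
/-- In characteristic `p`, the sum of the powers `n ^ (p - 1)` over `n < p` equals `-1`. -/
theorem sum_range_natCast_pow_prime_sub_one {A : Type*} [Ring A] {p : ℕ} (hp : p.Prime)
    [CharP A p] : ∑ n ∈ range p, (n : A) ^ (p - 1) = -1 := by
  have : Fact p.Prime := ⟨hp⟩
  have h : ∑ n ∈ range p, (n : ZMod p) ^ (p - 1) = -1 := by
    obtain ⟨q, rfl⟩ : ∃ q, p = q + 1 := ⟨p - 1, by have := hp.pos; omega⟩
    have hq : q ≠ 0 := by rintro rfl; exact Nat.not_prime_one hp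
    rw [sum_range_succ', Nat.add_sub_cancel, Nat.cast_zero, zero_pow hq, add_zero]
    rw [sum_congr rfl (g := fun _ ↦ 1)]
    · have := ZMod.natCast_self (q + 1)
      push_cast at this
      simp [eq_neg_of_add_eq_zero_left this]
    · intro n hn
      refine ZMod.pow_card_sub_one_eq_one (p := q + 1) ?_
      rw [Ne, ZMod.natCast_eq_zero_iff]
      intro hd
      have := Nat.le_of_dvd (Nat.succ_pos n) hd
      have := mem_range.mp hn
      omega
  simpa using congrArg (ZMod.castHom dvd_rfl A) h

open Finset in
/-- In characteristic `p`, the sum of the translates `(E + n) ^ (p - 1)` over `n < p`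
equals `-1`. -/
theorem sum_range_add_natCast_pow_prime_sub_one {A : Type*} [Ring A] {p : ℕ} (hp : p.Prime)
    [CharP A p] (E : A) : ∑ n ∈ range p, (E + n) ^ (p - 1) = -1 := by
  have h (n : ℕ) : (E + n) ^ (p - 1) = ∑ m ∈ range (p - 1 + 1),
      (E ^ m * ((p - 1).choose m : A)) * (n : A) ^ (p - 1 - m) := by
    rw [(Nat.cast_commute n E).symm.add_pow]
    refine sum_congr rfl fun m _ ↦ ?_
    rw [mul_assoc, mul_assoc, ((Nat.cast_commute ((p - 1).choose m) (n : A)).pow_right _).eq]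
  simp_rw [h]
  rw [sum_comm, sum_eq_single 0]
  · simp [sum_range_natCast_pow_prime_sub_one hp]
  · intro m hm hm0
    rw [← mul_sum, sum_range_natCast_pow_eq_zero hp, mul_zero]
    have := mem_range.mp hm
    omega
  · simp

/-- The trace pairing on the endomorphisms of a finite-dimensional space is nondegenerate. -/
theorem eq_zero_of_forall_trace_mul_eq_zero {k M : Type*} [Field k] [AddCommGroup M] [Module k M]
    [FiniteDimensional k M] {H : Module.End k M}
    (hH : ∀ A, LinearMap.trace k M (H * A) = 0) : H = 0 := by
  ext v
  refine (Module.forall_dual_apply_eq_zero_iff k _).mp fun f ↦ ?_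
  have h := hH (dualTensorHom k M M (f ⊗ₜ v))
  have h' : H * dualTensorHom k M M (f ⊗ₜ v) = dualTensorHom k M M (f ⊗ₜ H v) := by
    ext x
    simp
  rw [h'] at h
  simpa [LinearMap.trace_eq_contract_apply] using h

/-- Every linear functional on the endomorphisms of a finite-dimensional space is the trace
pairing with some endomorphism. -/
theorem exists_trace_mul_eq {k M : Type*} [Field k] [AddCommGroup M] [Module k M]
    [FiniteDimensional k M] (l : Module.Dual k (Module.End k M)) :
    ∃ H : Module.End k M, ∀ A, LinearMap.trace k M (H * A) = l A := by
  let T : Module.End k M →ₗ[k] Module.Dual k (Module.End k M) :=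
    (LinearMap.mul k (Module.End k M)).compr₂ (LinearMap.trace k M)
  have hT : Function.Injective T := by
    rw [injective_iff_map_eq_zero]
    exact fun H hH ↦ eq_zero_of_forall_trace_mul_eq_zero (LinearMap.congr_fun hH)
  obtain ⟨H, hH⟩ := (LinearMap.injective_iff_surjective_of_finrank_eq_finrank
    (Subspace.dual_finrank_eq (K := k) (V := Module.End k M)).symm).mp hT l
  exact ⟨H, LinearMap.congr_fun hH⟩

/-- If every endomorphism commuting with the automorphism `u` has trace zero, then some
conjugate difference `u E u⁻¹ - E` is the identity. -/
theorem exists_conj_eq_add_one {k M : Type*} [Field k] [AddCommGroup M] [Module k M]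
    [FiniteDimensional k M] (u : (Module.End k M)ˣ)
    (h : ∀ f : Module.End k M, Commute (u : Module.End k M) f → LinearMap.trace k M f = 0) :
    ∃ E : Module.End k M, u * E * (u⁻¹ : (Module.End k M)ˣ) = E + 1 := by
  let D : Module.End k M →ₗ[k] Module.End k M :=
    LinearMap.mulLeft k (u : Module.End k M) ∘ₗ
      LinearMap.mulRight k ((u⁻¹ : (Module.End k M)ˣ) : Module.End k M) - LinearMap.id
  have hD (A : Module.End k M) : D A = u * (A * (u⁻¹ : (Module.End k M)ˣ)) - A := rfl
  by_cases h1 : (1 : Module.End k M) ∈ LinearMap.range D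
  · obtain ⟨E, hE⟩ := h1
    rw [hD] at hE
    exact ⟨E, by rw [mul_assoc, ← hE]; abel⟩
  · obtain ⟨l, hl1, hl⟩ := Submodule.exists_dual_map_eq_bot_of_notMem h1 inferInstance
    obtain ⟨H, hH⟩ := exists_trace_mul_eq l
    refine absurd ?_ hl1
    rw [← hH, mul_one]
    refine h H ?_
    obtain ⟨H', hH'⟩ : ∃ H', H' = ((u⁻¹ : (Module.End k M)ˣ) : Module.End k M) * H * u - H :=
      ⟨_, rfl⟩
    have h0 (A : Module.End k M) : LinearMap.trace k M (H' * A) = 0 := by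
      have hA : l (D A) = 0 := by
        rw [← Submodule.mem_bot k, ← hl]
        exact Submodule.mem_map_of_mem (LinearMap.mem_range_self D A)
      rw [← hH, hD, mul_sub, map_sub] at hA
      rw [hH', sub_mul, map_sub, ← hA, mul_assoc, mul_assoc, LinearMap.trace_mul_comm]
      simp only [mul_assoc]
    have h2 := eq_zero_of_forall_trace_mul_eq_zero h0
    rw [hH', sub_eq_zero] at h2
    calc (u : Module.End k M) * H = u * ((u⁻¹ : (Module.End k M)ˣ) * H * u) := by rw [h2]
      _ = H * u := by simp [← mul_assoc]

/-- Higman's criterion: a representation is projective if the identity is the sum of the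
conjugates of a linear endomorphism. -/
theorem projective_asModule_of_sum_conj_eq_one {k G M : Type*} [Field k] [Group G] [Fintype G]
    [AddCommGroup M] [Module k M] (ρ : Representation k G M) (θ : Module.End k M)
    (hθ : ∑ g : G, ρ g * θ * ρ g⁻¹ = 1) :
    Module.Projective (MonoidAlgebra k G) ρ.asModule := by
  refine Module.Projective.of_lifting_property'' fun f hf ↦ ?_
  obtain ⟨s, hs⟩ := (f.restrictScalars k).exists_rightInverse_of_surjective
    (LinearMap.range_eq_top.mpr hf)
  let θ' : ρ.asModule →ₗ[k] ρ.asModule :=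
    ρ.asModuleEquiv.symm.toLinearMap ∘ₗ θ ∘ₗ ρ.asModuleEquiv.toLinearMap
  refine ⟨(s ∘ₗ θ').sumOfConjugatesEquivariant G, LinearMap.ext fun v ↦ ?_⟩
  have hfs (x) : f (s x) = x := LinearMap.congr_fun hs x
  rw [LinearMap.comp_apply, LinearMap.sumOfConjugatesEquivariant_apply, map_sum]
  simp only [LinearMap.conjugate_apply, map_smul, LinearMap.comp_apply, hfs]
  rw [LinearMap.id_apply]
  have h := LinearMap.congr_fun hθ (ρ.asModuleEquiv v)
  rw [← Equiv.sum_comp (Equiv.inv G)] at h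
  simp only [Equiv.inv_apply, inv_inv, LinearMap.sum_apply, Module.End.mul_apply,
    Module.End.one_apply] at h
  apply ρ.asModuleEquiv.injective
  rw [← h, map_sum]
  refine Finset.sum_congr rfl fun g _ ↦ ?_
  simp only [θ', Representation.asModuleEquiv_map_smul, Representation.asAlgebraHom_single_one,
    LinearMap.comp_apply, LinearEquiv.coe_coe, LinearEquiv.apply_symm_apply]

/-- An equivariant endomorphism of an indecomposable representation over an algebraically
closed field has a single eigenvalue, so its trace is a multiple of the dimension. -/
theorem IndecomposableRep.exists_trace_eq_mul_finrank {k G M : Type} [Field k] [IsAlgClosed k]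
    [Group G] [AddCommGroup M] [Module k M] [FiniteDimensional k M] {ρ : Representation k G M}
    (hρ : IndecomposableRep ρ) {f : Module.End k M} (hf : Equivariant ρ ρ f) :
    ∃ c : k, LinearMap.trace k M f = c * Module.finrank k M := by
  obtain ⟨hM, hdec⟩ := hρ
  obtain ⟨c, hc⟩ := Module.End.exists_eigenvalue f
  refine ⟨c, ?_⟩
  obtain ⟨N, hN⟩ : ∃ N, N = f - algebraMap k (Module.End k M) c := ⟨_, rfl⟩
  have hcomm (g : G) (n : ℕ) : Commute (N ^ n) (ρ g) := by
    refine Commute.pow_left ?_ n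
    rw [hN]
    exact Commute.sub_left (hf g) (Algebra.commutes c (ρ g))
  obtain ⟨n, hn⟩ := (N.eventually_isCompl_ker_pow_range_pow.and
    (Filter.eventually_ge_atTop 1)).exists
  have hker : LinearMap.ker (N ^ n) ≠ ⊥ := by
    obtain ⟨v, hv⟩ := hc.exists_hasEigenvector
    intro hbot
    refine hv.2 ((Submodule.mem_bot k).mp ?_)
    rw [← hbot, LinearMap.mem_ker]
    have hNv : N v = 0 := by
      rw [hN, LinearMap.sub_apply, hv.apply_eq_smul, Module.algebraMap_end_apply, sub_self]
    rw [← Nat.sub_add_cancel hn.2, pow_succ, Module.End.mul_apply, hNv, map_zero]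
  have hrange : LinearMap.range (N ^ n) = ⊥ := by
    by_contra hr
    refine hdec ⟨_, _, ?_, ?_, hn.1, hker, hr⟩
    · intro g x hx
      rw [LinearMap.mem_ker] at hx ⊢
      rw [← Module.End.mul_apply, (hcomm g n).eq, Module.End.mul_apply, hx, map_zero]
    · rintro g _ ⟨y, rfl⟩
      exact ⟨ρ g y, LinearMap.congr_fun (hcomm g n).eq y⟩
  have hnil : IsNilpotent N := ⟨n, LinearMap.range_eq_bot.mp hrange⟩
  have htr := (LinearMap.isNilpotent_trace_of_isNilpotent hnil).eq_zero
  rw [hN, map_sub, sub_eq_zero] at htr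
  rw [htr, Algebra.algebraMap_eq_smul_one, map_smul, LinearMap.trace_one, smul_eq_mul]

/-- An endomorphism commuting with a subgroup of a finite group has a relative trace, which is
an equivariant endomorphism whose trace is multiplied by the index. -/
theorem exists_equivariant_trace_eq_index_mul {k G M : Type} [Field k] [Group G] [Finite G]
    [AddCommGroup M] [Module k M] (ρ : Representation k G M)
    (P : Subgroup G) {f : Module.End k M} (hf : ∀ g ∈ P, Commute (ρ g) f) :
    ∃ F : Module.End k M, Equivariant ρ ρ F ∧
      LinearMap.trace k M F = P.index * LinearMap.trace k M f := by
  have := Fintype.ofFinite (G ⧸ P)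
  let c : G ⧸ P → Module.End k M := Quotient.lift (fun x ↦ ρ x * f * ρ x⁻¹) fun x y hxy ↦ by
    obtain ⟨z, rfl⟩ : ∃ z, y = x * z := ⟨x⁻¹ * y, by group⟩
    have h : Commute (ρ z) f := hf z (by simpa using QuotientGroup.leftRel_apply.mp hxy)
    calc ρ x * f * ρ x⁻¹ = ρ x * (f * ρ z) * ρ z⁻¹ * ρ x⁻¹ := by
          rw [← mul_assoc, mul_assoc _ (ρ z), ← map_mul ρ z, mul_inv_cancel, map_one, mul_one]
      _ = ρ (x * z) * f * ρ (x * z)⁻¹ := by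
          rw [← h.eq, mul_inv_rev, map_mul, map_mul]
          simp only [mul_assoc]
  have hc (g : G) (q : G ⧸ P) : ρ g * c q = c (g • q) * ρ g := by
    induction q using QuotientGroup.induction_on with
    | H x =>
      change ρ g * (ρ x * f * ρ x⁻¹) = ρ (g * x) * f * ρ (g * x)⁻¹ * ρ g
      rw [mul_inv_rev, map_mul, map_mul]
      simp only [mul_assoc, ← map_mul ρ g⁻¹ g, inv_mul_cancel, map_one, mul_one]
  have htr (q : G ⧸ P) : LinearMap.trace k M (c q) = LinearMap.trace k M f := by
    induction q using QuotientGroup.induction_on with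
    | H x =>
      change LinearMap.trace k M (ρ x * f * ρ x⁻¹) = _
      rw [LinearMap.trace_mul_comm, ← mul_assoc, ← map_mul, inv_mul_cancel, map_one, one_mul]
  refine ⟨∑ q, c q, fun g ↦ ?_, ?_⟩
  · change (∑ q, c q) * ρ g = ρ g * ∑ q, c q
    rw [Finset.mul_sum, Finset.sum_mul, ← Equiv.sum_comp (MulAction.toPerm g)]
    exact Finset.sum_congr rfl fun q _ ↦ (hc g q).symm
  · simp [htr, Subgroup.index, Nat.card_eq_fintype_card]

/-- A linear endomorphism whose conjugates under a subgroup sum to the identity has conjugates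
under the whole group summing to the index. -/
theorem sum_conj_eq_index {k G M : Type*} [Field k] [Group G] [Fintype G]
    [AddCommGroup M] [Module k M] (ρ : Representation k G M)
    (P : Subgroup G) [Fintype P] {θ : Module.End k M}
    (hθ : ∑ g : P, ρ g * θ * ρ (g : G)⁻¹ = 1) :
    ∑ g : G, ρ g * θ * ρ g⁻¹ = P.index := by
  have := Fintype.ofFinite (G ⧸ P)
  have hbij : Function.Bijective fun a : (G ⧸ P) × P ↦ a.1.out * (a.2 : G) := by
    constructor
    · rintro ⟨q, h⟩ ⟨q', h'⟩ heq
      have hq := congrArg (QuotientGroup.mk (s := P)) heq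
      simp only [QuotientGroup.mk_mul_of_mem _ (SetLike.coe_mem _), QuotientGroup.out_eq'] at hq
      subst hq
      simpa using heq
    · intro g
      obtain ⟨h, hh⟩ := QuotientGroup.mk_out_eq_mul P g
      exact ⟨(g, h⁻¹), by simp [hh]⟩
  rw [← Fintype.sum_bijective _ hbij _ _ fun _ ↦ rfl, Fintype.sum_prod_type]
  have h (q : G ⧸ P) : ∑ h : P, ρ (q.out * h) * θ * ρ (q.out * (h : G))⁻¹ = 1 := by
    calc _ = ∑ h : P, ρ q.out * (ρ h * θ * ρ (h : G)⁻¹) * ρ q.out⁻¹ := by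
          refine Finset.sum_congr rfl fun h _ ↦ ?_
          rw [mul_inv_rev, map_mul, map_mul]
          simp only [mul_assoc]
      _ = 1 := by
          rw [← Finset.sum_mul, ← Finset.mul_sum, hθ, mul_one, ← map_mul, mul_inv_cancel, map_one]
  simp only [h, Finset.sum_const, Finset.card_univ, nsmul_one, Subgroup.index,
    Nat.card_eq_fintype_card]

/-- If the Sylow `p`-subgroups of `G` have order exactly `p` and `k` is algebraically
closed of characteristic `p`, then every non-projective finite-dimensional
indecomposable `kG`-module has dimension prime to `p`. -/
theorem nonprojective_indecomposable_has_dimension_prime_to_p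
    (p : ℕ) (hp : p.Prime) (k : Type) [Field k] [IsAlgClosed k] [CharP k p]
    (G : Type) [Group G] [Fintype G]
    (h1 : p ∣ Fintype.card G) (h2 : ¬ (p ^ 2 ∣ Fintype.card G))
    (M : Type) [AddCommGroup M] [Module k M] [FiniteDimensional k M]
    (ρ : Representation k G M) (hind : IndecomposableRep ρ)
    (hproj : ¬ Module.Projective (MonoidAlgebra k G) ρ.asModule) :
    ¬ (p ∣ Module.finrank k M) := by
  intro hdim
  have := hind.1
  have hpF : Fact p.Prime := ⟨hp⟩
  obtain ⟨x, hx⟩ := exists_prime_orderOf_dvd_card p h1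
  obtain ⟨P, hP⟩ : ∃ P, P = Subgroup.zpowers x := ⟨_, rfl⟩
  have hcard : Nat.card P = p := by rw [hP, Nat.card_zpowers, hx]
  have hindex : (P.index : k) ≠ 0 := by
    rw [Ne, CharP.cast_eq_zero_iff k p]
    rintro ⟨m, hm⟩
    refine h2 ⟨m, ?_⟩
    rw [← Nat.card_eq_fintype_card, ← P.card_mul_index, hcard, hm]
    ring
  let u : (Module.End k M)ˣ := ⟨ρ x, ρ x⁻¹, by simp [← map_mul], by simp [← map_mul]⟩
  have hu (n : ℕ) : ((u ^ n : (Module.End k M)ˣ) : Module.End k M) = ρ (x ^ n) := by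
    rw [Units.val_pow_eq_pow_val, map_pow]
  obtain ⟨E, hE⟩ := exists_conj_eq_add_one u fun f hf ↦ by
    obtain ⟨F, hF, htr⟩ := exists_equivariant_trace_eq_index_mul ρ P (f := f) <| by
      intro g hg
      rw [hP, ← mem_powers_iff_mem_zpowers] at hg
      obtain ⟨n, rfl⟩ := hg
      simp only [map_pow]
      exact Commute.pow_left hf n
    obtain ⟨c, hc⟩ := hind.exists_trace_eq_mul_finrank hF
    rw [hc, (CharP.cast_eq_zero_iff k p _).mpr hdim, mul_zero] at htr
    exact (mul_eq_zero.mp htr.symm).resolve_left hindex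
  replace hE : ρ x * E * ρ x⁻¹ = E + 1 := hE
  have hpow (n : ℕ) : ρ (x ^ n) * E * ρ (x ^ n)⁻¹ = E + n := by
    induction n with
    | zero => simp
    | succ n ih =>
      calc ρ (x ^ (n + 1)) * E * ρ (x ^ (n + 1))⁻¹
          = ρ (x ^ n) * (ρ x * E * ρ x⁻¹) * ρ (x ^ n)⁻¹ := by
            rw [pow_succ, mul_inv_rev, map_mul, map_mul]
            simp only [mul_assoc]
        _ = E + (n + 1 : ℕ) := by
            rw [hE, mul_add, add_mul, ih, mul_one, ← map_mul, mul_inv_cancel, map_one]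
            push_cast
            rw [add_assoc]
  have hchar : CharP (Module.End k M) p :=
    charP_of_injective_algebraMap (algebraMap k (Module.End k M)).injective p
  have hconj (g : G) (m : ℕ) : ρ g * E ^ m * ρ g⁻¹ = (ρ g * E * ρ g⁻¹) ^ m := by
    let v : (Module.End k M)ˣ := ⟨ρ g, ρ g⁻¹, by simp [← map_mul], by simp [← map_mul]⟩
    exact (v.conj_pow E m).symm
  have := Fintype.ofFinite P
  have hsum : ∑ g : P, ρ g * (-E ^ (p - 1)) * ρ (g : G)⁻¹ = 1 := by
    subst hP
    rw [← Equiv.sum_comp (finEquivZPowers (isOfFinOrder_of_finite x))]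
    simp only [finEquivZPowers_apply, mul_neg, neg_mul, hconj, hpow, Finset.sum_neg_distrib]
    rw [Fin.sum_univ_eq_sum_range (fun n ↦ (E + (n : Module.End k M)) ^ (p - 1)), hx,
      sum_range_add_natCast_pow_prime_sub_one hp, neg_neg]
  refine hproj (projective_asModule_of_sum_conj_eq_one ρ ((P.index : k)⁻¹ • (-E ^ (p - 1))) ?_)
  simp only [mul_smul_comm, smul_mul_assoc, ← Finset.smul_sum]
  rw [sum_conj_eq_index ρ P hsum, ← map_natCast (algebraMap k (Module.End k M)),
    Algebra.algebraMap_eq_smul_one, smul_smul, inv_mul_cancel₀ hindex, one_smul]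
end

section
/- Let k be a field of characteristic p > 0, let G = ⟨g⟩ be a cyclic group of order p^n with n ≥ 1, and let H = ⟨g^{p^{n−m}}⟩ be its subgroup of order p^m with 1 ≤ m ≤ n. Let M be a finitely generated kG-module having no nonzero projective direct summand, and suppose that the restriction of M to H has a nonzero projective kH-direct summand. Then the restriction of M to H has an indecomposable direct summand of k-dimension p^m − 1 = |H| − 1. -/
open TensorProduct

section Defs

variable {k G : Type} [Field k] [Group G]

/-- `ρU` is (isomorphic to) a direct summand of `ρM`, witnessed by an equivariant
split monomorphism. -/
def IsDirectSummandRep {U M : Type} [AddCommGroup U] [Module k U]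
    [AddCommGroup M] [Module k M]
    (ρU : Representation k G U) (ρM : Representation k G M) : Prop :=
  ∃ (i : U →ₗ[k] M) (r : M →ₗ[k] U),
    Equivariant ρU ρM i ∧ Equivariant ρM ρU r ∧ r ∘ₗ i = LinearMap.id

end Defs

section PowersOfEndomorphism

variable {k V : Type*} [Field k] [AddCommGroup V] [Module k V]

lemma sum_smul_pow_eq_zero_imp (F : Module.End k V) (φ : V →ₗ[k] k) (l : ℕ) (w : V)
    (hφ : ∀ x, φ ((F ^ (l + 1)) x) = 0) (hw : φ ((F ^ l) w) ≠ 0) (c : Fin (l + 1) → k)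
    (hc : ∀ i ≤ l, φ ((F ^ i) (∑ j, c j • (F ^ (j : ℕ)) w)) = 0) : c = 0 := by
  suffices h : ∀ i (hi : i < l + 1), c ⟨i, hi⟩ = 0 by
    ext ⟨i, hi⟩
    exact h i hi
  intro i
  induction i using Nat.strong_induction_on with
  | _ i ih =>
    intro hi
    have h := hc (l - i) (Nat.sub_le _ _)
    rw [map_sum, map_sum, Finset.sum_eq_single ⟨i, hi⟩] at h
    · rw [map_smul, map_smul, ← Module.End.mul_apply, ← pow_add] at h
      have e : l - i + i = l := by omega
      simp only [e, smul_eq_mul] at h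
      exact (mul_eq_zero.mp h).resolve_right hw
    · rintro ⟨j, hj⟩ - hne
      rcases lt_or_ge j i with hji | hji
      · rw [ih j hji hj]
        simp
      · have hij : i < j := lt_of_le_of_ne hji fun e => hne (by simp [e])
        obtain ⟨e, he⟩ := Nat.exists_eq_add_of_le (show l + 1 ≤ l - i + j by omega)
        rw [map_smul, map_smul, ← Module.End.mul_apply, ← pow_add]
        simp only [he]
        rw [pow_add, Module.End.mul_apply, hφ, smul_zero]
    · simp

lemma linearIndependent_pow_apply (F : Module.End k V) (φ : V →ₗ[k] k) (l : ℕ) (w : V)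
    (hφ : ∀ x, φ ((F ^ (l + 1)) x) = 0) (hw : φ ((F ^ l) w) ≠ 0) :
    LinearIndependent k fun i : Fin (l + 1) => (F ^ (i : ℕ)) w := by
  rw [Fintype.linearIndependent_iff]
  intro c hc i
  exact congrFun (sum_smul_pow_eq_zero_imp F φ l w hφ hw c fun i _ => by rw [hc]; simp) i

/-- A vector `w` killed by `F ^ (l + 1)` and a functional `φ` vanishing on the range of
`F ^ (l + 1)` with `φ (F ^ l w) ≠ 0` split off the span of `w, F w, …, F ^ l w`. -/
lemma exists_isCompl_span_pow_apply (F : Module.End k V) (φ : V →ₗ[k] k) (l : ℕ) (w : V)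
    (hφ : ∀ x, φ ((F ^ (l + 1)) x) = 0) (hw : φ ((F ^ l) w) ≠ 0) (hFw : (F ^ (l + 1)) w = 0) :
    ∃ K : Submodule k V,
      IsCompl (Submodule.span k (Set.range fun i : Fin (l + 1) => (F ^ (i : ℕ)) w)) K ∧
      (∀ x ∈ Submodule.span k (Set.range fun i : Fin (l + 1) => (F ^ (i : ℕ)) w),
        F x ∈ Submodule.span k (Set.range fun i : Fin (l + 1) => (F ^ (i : ℕ)) w)) ∧
      (∀ x ∈ K, F x ∈ K) := by
  let A : V →ₗ[k] (Fin (l + 1) → k) := LinearMap.pi fun i => φ ∘ₗ F ^ (i : ℕ)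
  let B : (Fin (l + 1) → k) →ₗ[k] V := Fintype.linearCombination k fun i => (F ^ (i : ℕ)) w
  have hB (c) : B c = ∑ j, c j • (F ^ (j : ℕ)) w := rfl
  have hker (x) : x ∈ LinearMap.ker A ↔ ∀ i ≤ l, φ ((F ^ i) x) = 0 := by
    rw [LinearMap.mem_ker, funext_iff]
    exact ⟨fun h i hi => h ⟨i, by omega⟩, fun h i => h i (by omega)⟩
  have hinj : Function.Injective (A ∘ₗ B) := by
    rw [injective_iff_map_eq_zero]
    intro c hc
    exact sum_smul_pow_eq_zero_imp F φ l w hφ hw c ((hker _).mp hc)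
  have hsurj := LinearMap.injective_iff_surjective.mp hinj
  have hrange : LinearMap.range B =
      Submodule.span k (Set.range fun i : Fin (l + 1) => (F ^ (i : ℕ)) w) :=
    Fintype.range_linearCombination k _
  refine ⟨LinearMap.ker A, ?_, ?_, ?_⟩
  · rw [← hrange]
    constructor
    · rw [Submodule.disjoint_def]
      rintro _ ⟨c, rfl⟩ hc
      have : c = 0 := hinj (by rw [map_zero]; exact hc)
      rw [this, map_zero]
    · rw [codisjoint_iff_le_sup]
      intro x _
      obtain ⟨c, hc⟩ := hsurj (A x)
      refine Submodule.mem_sup.mpr ⟨B c, ⟨c, rfl⟩, x - B c, ?_, by abel⟩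
      rw [LinearMap.mem_ker, map_sub, ← hc, LinearMap.comp_apply, sub_self]
  · intro x hx
    induction hx using Submodule.span_induction with
    | mem x h =>
      obtain ⟨⟨i, hi⟩, rfl⟩ := h
      simp only
      rw [← Module.End.mul_apply, ← pow_succ']
      rcases Nat.lt_or_ge (i + 1) (l + 1) with h | h
      · exact Submodule.subset_span ⟨⟨i + 1, h⟩, rfl⟩
      · rw [show i + 1 = l + 1 by omega, hFw]
        exact zero_mem _
    | zero => simp
    | add x y _ _ hx hy => rw [map_add]; exact add_mem hx hy
    | smul a x _ hx => rw [map_smul]; exact Submodule.smul_mem _ _ hx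
  · intro x hx
    rw [hker] at hx ⊢
    intro i hi
    rw [← Module.End.mul_apply, ← pow_succ]
    rcases Nat.lt_or_ge i l with h | h
    · exact hx _ h
    · rw [show i + 1 = l + 1 by omega, hφ]

end PowersOfEndomorphism

section CyclicRepresentations

variable {k G V : Type} [Field k] [Group G] [AddCommGroup V] [Module k V]

lemma isSubrep_iff_sub_one (ρ : Representation k G V) [Finite G] {g : G}
    (hg : ∀ x, x ∈ Subgroup.zpowers g) (p : Submodule k V) :
    IsSubrep ρ p ↔ ∀ x ∈ p, (ρ g - 1 : Module.End k V) x ∈ p := by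
  constructor
  · intro h x hx
    exact sub_mem (h g x hx) hx
  · intro h a x hx
    have hstep (y) (hy : y ∈ p) : ρ g y ∈ p := by
      have := add_mem (h y hy) hy
      simpa using this
    obtain ⟨i, rfl⟩ := mem_powers_iff_mem_zpowers.mpr (hg a)
    simp only
    induction i generalizing x with
    | zero => simpa using hx
    | succ i ih =>
      rw [pow_succ, map_mul, Module.End.mul_apply]
      exact ih _ (hstep x hx)

lemma indecomposableRep_of_finrank_eq (ρ : Representation k G V) [Finite G]
    [FiniteDimensional k V] {g : G} (hg : ∀ x, x ∈ Subgroup.zpowers g) (φ : V →ₗ[k] k)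
    (l : ℕ) (w : V) (hφ : ∀ x, φ (((ρ g - 1 : Module.End k V) ^ (l + 1)) x) = 0)
    (hw : φ (((ρ g - 1 : Module.End k V) ^ l) w) ≠ 0) (hV : Module.finrank k V = l + 1) :
    IndecomposableRep ρ := by
  have eq_top (p : Submodule k V) (hp : IsSubrep ρ p) (a) (ha : a ∈ p)
      (h : φ (((ρ g - 1 : Module.End k V) ^ l) a) ≠ 0) : p = ⊤ := by
    have hmem (i : ℕ) : ((ρ g - 1 : Module.End k V) ^ i) a ∈ p := by
      induction i with
      | zero => exact ha
      | succ i ih =>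
        rw [pow_succ', Module.End.mul_apply]
        exact (isSubrep_iff_sub_one ρ hg p).mp hp _ ih
    have hli := linearIndependent_pow_apply _ φ l a hφ h
    have hspan := hli.span_eq_top_of_card_eq_finrank' (by rw [hV, Fintype.card_fin])
    rw [eq_top_iff, ← hspan, Submodule.span_le]
    rintro _ ⟨i, rfl⟩
    exact hmem i
  refine ⟨Module.nontrivial_of_finrank_pos (R := k) (by omega), ?_⟩
  rintro ⟨p, q, hp, hq, hpq, hp0, hq0⟩
  obtain ⟨a, ha, b, hb, rfl⟩ := Submodule.mem_sup.mp
    (hpq.sup_eq_top ▸ Submodule.mem_top : w ∈ p ⊔ q)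
  by_cases h : φ (((ρ g - 1 : Module.End k V) ^ l) a) = 0
  · rw [map_add, map_add, h, zero_add] at hw
    have := hpq.inf_eq_bot
    rw [eq_top q hq b hb hw, inf_top_eq] at this
    exact hp0 this
  · have := hpq.inf_eq_bot
    rw [eq_top p hp a ha h, top_inf_eq] at this
    exact hq0 this

lemma isDirectSummandRep_subrepresentation (ρ : Representation k G V) {U K : Submodule k V}
    (hUK : IsCompl U K) (hU : IsSubrep ρ U) (hK : IsSubrep ρ K) :
    IsDirectSummandRep (ρ.subrepresentation U hU) ρ := by
  refine ⟨U.subtype, U.projectionOnto K hUK, fun g => rfl, fun g => ?_, ?_⟩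
  · refine LinearMap.ext fun x => ?_
    obtain ⟨u, hu, v, hv, rfl⟩ := Submodule.mem_sup.mp
      (hUK.sup_eq_top ▸ Submodule.mem_top : x ∈ U ⊔ K)
    rw [LinearMap.comp_apply, LinearMap.comp_apply, map_add, map_add, map_add,
      Submodule.projectionOnto_apply_of_mem_left hUK hu,
      Submodule.projectionOnto_apply_of_mem_left hUK (hU g u hu),
      (Submodule.projectionOnto_apply_eq_zero_iff hUK).mpr hv,
      (Submodule.projectionOnto_apply_eq_zero_iff hUK).mpr (hK g v hv), add_zero, add_zero]
    rfl
  · exact Submodule.projectionOnto_comp_subtype hUK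

/-- A Jordan block of `ρ g - 1` detected by `w` and `φ` gives a direct summand. -/
lemma exists_isDirectSummandRep (ρ : Representation k G V) [Finite G]
    {g : G} (hg : ∀ x, x ∈ Subgroup.zpowers g) (φ : V →ₗ[k] k)
    (l : ℕ) (w : V) (hφ : ∀ x, φ (((ρ g - 1 : Module.End k V) ^ (l + 1)) x) = 0)
    (hw : φ (((ρ g - 1 : Module.End k V) ^ l) w) ≠ 0)
    (hFw : ((ρ g - 1 : Module.End k V) ^ (l + 1)) w = 0) :
    ∃ (U : Submodule k V) (hU : IsSubrep ρ U) (ψ : U →ₗ[k] k) (u : U),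
      IsDirectSummandRep (ρ.subrepresentation U hU) ρ ∧ Module.finrank k U = l + 1 ∧
      (∀ x, ψ (((ρ.subrepresentation U hU g - 1 : Module.End k U) ^ (l + 1)) x) = 0) ∧
      ψ (((ρ.subrepresentation U hU g - 1 : Module.End k U) ^ l) u) ≠ 0 := by
  obtain ⟨K, hUK, hU, hK⟩ := exists_isCompl_span_pow_apply _ φ l w hφ hw hFw
  rw [← isSubrep_iff_sub_one ρ hg] at hU hK
  have hpow (i : ℕ) (x) : ((((ρ.subrepresentation _ hU g - 1 : Module.End k _) ^ i) x :) : V) =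
      ((ρ g - 1 : Module.End k V) ^ i) x := by
    induction i with
    | zero => rfl
    | succ i ih =>
      rw [pow_succ', Module.End.mul_apply, pow_succ', Module.End.mul_apply, ← ih]
      rfl
  refine ⟨_, hU, φ ∘ₗ Submodule.subtype _, ⟨w, Submodule.subset_span ⟨0, by simp⟩⟩,
    isDirectSummandRep_subrepresentation ρ hUK hU hK, ?_, fun x => ?_, ?_⟩
  · rw [finrank_span_eq_card (linearIndependent_pow_apply _ φ l w hφ hw), Fintype.card_fin]
  · rw [LinearMap.comp_apply, Submodule.subtype_apply, hpow, hφ]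
  · rw [LinearMap.comp_apply, Submodule.subtype_apply, hpow]
    exact hw

lemma asAlgebraHom_of_sub_one_pow (ρ : Representation k G V) (g : G) (i : ℕ) :
    ρ.asAlgebraHom ((MonoidAlgebra.of k G g - 1) ^ i) = (ρ g - 1) ^ i := by
  rw [map_pow, map_sub, Representation.asAlgebraHom_of, map_one]

lemma projective_asModule_of_finrank_eq (ρ : Representation k G V) [Fintype G]
    [FiniteDimensional k V] (g : G) (φ : V →ₗ[k] k)
    (l : ℕ) (w : V) (hφ : ∀ x, φ (((ρ g - 1 : Module.End k V) ^ (l + 1)) x) = 0)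
    (hw : φ (((ρ g - 1 : Module.End k V) ^ l) w) ≠ 0) (hV : Module.finrank k V = l + 1)
    (hG : Fintype.card G = l + 1) :
    Module.Projective (MonoidAlgebra k G) ρ.asModule := by
  let f : MonoidAlgebra k G →ₗ[MonoidAlgebra k G] ρ.asModule :=
    LinearMap.toSpanSingleton _ _ (ρ.asModuleEquiv.symm w)
  let f' : MonoidAlgebra k G →ₗ[k] V := ρ.asAlgebraHom.toLinearMap.flip w
  have hspan := (linearIndependent_pow_apply _ φ l w hφ hw).span_eq_top_of_card_eq_finrank'
    (by rw [hV, Fintype.card_fin])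
  have hsurj : Function.Surjective f' := by
    rw [← LinearMap.range_eq_top, eq_top_iff, ← hspan, Submodule.span_le]
    rintro _ ⟨i, rfl⟩
    exact ⟨(MonoidAlgebra.of k G g - 1) ^ (i : ℕ),
      congrArg (· w) (asAlgebraHom_of_sub_one_pow ρ g i)⟩
  have hfin : Module.finrank k (MonoidAlgebra k G) = Module.finrank k V := by
    rw [hV, ← hG, Module.finrank_eq_card_basis (MonoidAlgebra.basis G k)]
  have hinj : Function.Injective f' :=
    (LinearMap.injective_iff_surjective_of_finrank_eq_finrank hfin).mpr hsurj
  exact Module.Projective.of_equiv (LinearEquiv.ofBijective f ⟨hinj, hsurj⟩)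

end CyclicRepresentations

section CharP

variable {k : Type*} [Field k] {p : ℕ} [CharP k p]

lemma sub_one_pow_char_pow {A : Type*} [Ring A] [Algebra k A] (hp : p.Prime) (a : A) (e : ℕ) :
    (a - 1) ^ p ^ e = a ^ p ^ e - 1 := by
  have := Fact.mk hp
  have h : (Polynomial.X - 1 : Polynomial k) ^ p ^ e = Polynomial.X ^ p ^ e - 1 := by
    rw [sub_pow_char_pow, one_pow]
  simpa using congrArg (Polynomial.aeval a) h

lemma sub_one_pow_char_pow_sub_one {A : Type*} [Ring A] [Algebra k A] (hp : p.Prime) (a : A)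
    (e : ℕ) : (a - 1) ^ (p ^ e - 1) = ∑ i ∈ Finset.range (p ^ e), a ^ i := by
  have := Fact.mk hp
  have h : (Polynomial.X - 1 : Polynomial k) ^ (p ^ e - 1) =
      ∑ i ∈ Finset.range (p ^ e), Polynomial.X ^ i := by
    have hX : (Polynomial.X - 1 : Polynomial k) ≠ 0 := Polynomial.X_sub_C_ne_zero 1
    refine mul_right_cancel₀ hX ?_
    rw [← pow_succ, Nat.sub_add_cancel (Nat.pos_of_ne_zero (pow_ne_zero _ hp.ne_zero)),
      geom_sum_mul, sub_pow_char_pow, one_pow]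
  simpa using congrArg (Polynomial.aeval a) h

lemma of_sub_one_pow_card_sub_one_ne_zero {G : Type*} [Group G] (hp : p.Prime) (g : G) (e : ℕ)
    (hg : orderOf g = p ^ e) : (MonoidAlgebra.of k G g - 1) ^ (p ^ e - 1) ≠ 0 := by
  rw [sub_one_pow_char_pow_sub_one (k := k) hp]
  intro h
  have h1 := congrArg (fun f : MonoidAlgebra k G => f.coeff 1) h
  have hpos : 0 < p ^ e := Nat.pos_of_ne_zero (pow_ne_zero _ hp.ne_zero)
  simp only [MonoidAlgebra.coeff_sum, Finsupp.finsetSum_apply, MonoidAlgebra.coeff_zero,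
    Finsupp.zero_apply] at h1
  rw [Finset.sum_eq_single 0] at h1
  · simp at h1
  · intro i hi hi0
    rw [← map_pow, MonoidAlgebra.of_apply, MonoidAlgebra.coeff_single]
    refine Finsupp.single_eq_of_ne' fun h => ?_
    exact pow_ne_one_of_lt_orderOf hi0 (hg ▸ Finset.mem_range.mp hi) h
  · intro h0
    exact absurd (Finset.mem_range.mpr hpos) h0

/-- An element of the group algebra of a cyclic `p`-group annihilated by `(g - 1) ^ (|G| - 1)`
is a multiple of `g - 1`. -/
lemma exists_eq_of_sub_one_mul {G : Type*} [Group G] [Finite G] (hp : p.Prime) (g : G)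
    (hg : ∀ x, x ∈ Subgroup.zpowers g) (e : ℕ) (he : orderOf g = p ^ e) (f : MonoidAlgebra k G)
    (hf : (MonoidAlgebra.of k G g - 1) ^ (p ^ e - 1) * f = 0) :
    ∃ f', f = (MonoidAlgebra.of k G g - 1) * f' := by
  have hdecomp : ∃ (c : k) (f' : MonoidAlgebra k G),
      f = c • 1 + (MonoidAlgebra.of k G g - 1) * f' := by
    clear hf
    induction f using MonoidAlgebra.induction_on with
    | of x =>
      obtain ⟨i, rfl⟩ := mem_powers_iff_mem_zpowers.mpr (hg x)
      refine ⟨1, ∑ j ∈ Finset.range i, MonoidAlgebra.of k G g ^ j, ?_⟩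
      rw [mul_geom_sum]
      simp
    | add a b ha hb =>
      obtain ⟨c, a', rfl⟩ := ha
      obtain ⟨d, b', rfl⟩ := hb
      exact ⟨c + d, a' + b', by rw [add_smul, mul_add]; abel⟩
    | smul r a ha =>
      obtain ⟨c, a', rfl⟩ := ha
      exact ⟨r * c, r • a', by rw [smul_add, mul_smul, mul_smul_comm]⟩
  obtain ⟨c, f', rfl⟩ := hdecomp
  have hpow : (MonoidAlgebra.of k G g - 1) ^ (p ^ e) = 0 := by
    rw [sub_one_pow_char_pow (k := k) hp, ← map_pow, ← he, pow_orderOf_eq_one, map_one, sub_self]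
  rw [mul_add, ← mul_assoc, ← pow_succ,
    Nat.sub_add_cancel (Nat.pos_of_ne_zero (pow_ne_zero _ hp.ne_zero)), hpow, zero_mul, add_zero,
    mul_smul_comm, mul_one] at hf
  rcases smul_eq_zero.mp hf with rfl | h
  · exact ⟨f', by simp⟩
  · exact absurd h (of_sub_one_pow_card_sub_one_ne_zero hp g e he)

lemma sub_one_pow_ne_zero_of_projective {k G Q : Type} [Field k] {p : ℕ} [CharP k p]
    [Group G] [Finite G] [AddCommGroup Q] [Module k Q] [Nontrivial Q] (ρ : Representation k G Q)
    [Module.Projective (MonoidAlgebra k G) ρ.asModule] (hp : p.Prime) (g : G)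
    (hg : ∀ x, x ∈ Subgroup.zpowers g) (e : ℕ) (he : orderOf g = p ^ e) :
    (ρ g - 1 : Module.End k Q) ^ (p ^ e - 1) ≠ 0 := by
  intro h0
  obtain ⟨s, hs⟩ := Module.projective_def'.mp
    (inferInstance : Module.Projective (MonoidAlgebra k G) ρ.asModule)
  have hsurj : Function.Surjective (ρ g - 1 : Module.End k Q) := by
    intro x
    let y : ρ.asModule := ρ.asModuleEquiv.symm x
    have hy0 : (MonoidAlgebra.of k G g - 1) ^ (p ^ e - 1) • y = 0 := by
      change ρ.asAlgebraHom _ x = 0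
      rw [asAlgebraHom_of_sub_one_pow, h0, LinearMap.zero_apply]
    have hdvd (i) : ∃ f', s y i = (MonoidAlgebra.of k G g - 1) * f' := by
      refine exists_eq_of_sub_one_mul hp g hg e he _ ?_
      rw [← smul_eq_mul, ← Finsupp.smul_apply, ← map_smul, hy0, map_zero, Finsupp.zero_apply]
    choose f' hf' using hdvd
    refine ⟨ρ.asModuleEquiv (∑ i ∈ (s y).support, f' i • i), ?_⟩
    have hy : y = (MonoidAlgebra.of k G g - 1) • ∑ i ∈ (s y).support, f' i • i := by
      conv_lhs => rw [← LinearMap.id_apply (R := MonoidAlgebra k G) y, ← hs]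
      rw [LinearMap.comp_apply, Finsupp.linearCombination_apply, Finsupp.sum, Finset.smul_sum]
      exact Finset.sum_congr rfl fun i _ => by rw [hf', mul_smul]; rfl
    have h1 := asAlgebraHom_of_sub_one_pow ρ g 1
    rw [pow_one, pow_one] at h1
    rw [← h1]
    exact hy.symm
  have hsurj' : Function.Surjective ((ρ g - 1 : Module.End k Q) ^ (p ^ e - 1)) := by
    rw [Module.End.coe_pow]
    exact hsurj.iterate _
  obtain ⟨x, hx⟩ := exists_ne (0 : Q)
  obtain ⟨y, rfl⟩ := hsurj' x
  exact hx (by rw [h0, LinearMap.zero_apply])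

end CharP

lemma Equivariant.sub_one_pow_apply {k G V W : Type} [Field k] [Group G] [AddCommGroup V]
    [Module k V] [AddCommGroup W] [Module k W] {ρV : Representation k G V}
    {ρW : Representation k G W} {f : V →ₗ[k] W} (hf : Equivariant ρV ρW f) (g : G) (i : ℕ) (x : V) :
    f (((ρV g - 1 : Module.End k V) ^ i) x) = ((ρW g - 1 : Module.End k W) ^ i) (f x) := by
  induction i with
  | zero => rfl
  | succ i ih =>
    rw [pow_succ', Module.End.mul_apply, pow_succ', Module.End.mul_apply, ← ih,
      LinearMap.sub_apply, LinearMap.sub_apply, map_sub]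
    exact congrArg (· - _) (LinearMap.congr_fun (hf g) _)

lemma exists_generator_pow {G : Type} [Group G] [Fintype G] [IsCyclic G] {p n m : ℕ}
    (hp : p.Prime) (hmn : m ≤ n) (hcard : Fintype.card G = p ^ n) (H : Subgroup G)
    (hH : Nat.card H = p ^ m) :
    ∃ (g : G) (h : H), (∀ x, x ∈ Subgroup.zpowers g) ∧ (∀ x, x ∈ Subgroup.zpowers h) ∧
      orderOf g = p ^ n ∧ orderOf h = p ^ m ∧ (h : G) = g ^ p ^ (n - m) := by
  obtain ⟨g, hg⟩ := IsCyclic.exists_generator (α := G)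
  have hog : orderOf g = p ^ n := by
    rw [orderOf_eq_card_of_forall_mem_zpowers hg, Nat.card_eq_fintype_card, hcard]
  have hpn : p ^ n = p ^ (n - m) * p ^ m := by rw [← pow_add, Nat.sub_add_cancel hmn]
  have hpos (e : ℕ) : 0 < p ^ e := Nat.pos_of_ne_zero (pow_ne_zero _ hp.ne_zero)
  have hindex : H.index = p ^ (n - m) := by
    have := H.card_mul_index
    rw [hH, Nat.card_eq_fintype_card, hcard, hpn, mul_comm] at this
    exact Nat.eq_of_mul_eq_mul_right (hpos m) this
  have hnormal : H.Normal := by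
    let := IsCyclic.commGroup (α := G)
    exact H.normal_of_isMulCommutative
  have hmem : g ^ p ^ (n - m) ∈ H := hindex ▸ H.pow_index_mem g
  have hoh : orderOf (⟨g ^ p ^ (n - m), hmem⟩ : H) = p ^ m := by
    have hdvd : p ^ (n - m) ∣ orderOf g := by rw [hog, hpn]; exact Dvd.intro _ rfl
    rw [← Subgroup.orderOf_coe, orderOf_pow_of_dvd (hpos _).ne' hdvd, hog, hpn,
      Nat.mul_div_cancel_left _ (hpos _)]
  refine ⟨g, ⟨_, hmem⟩, hg, fun x => ?_, hog, hoh, rfl⟩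
  have : Subgroup.zpowers (⟨g ^ p ^ (n - m), hmem⟩ : H) = ⊤ :=
    Subgroup.eq_top_of_card_eq _ (by rw [Nat.card_zpowers, hoh, hH])
  rw [this]
  exact Subgroup.mem_top x

/-- Let `G` be cyclic of order `pⁿ` and `H ≤ G` its subgroup of order `pᵐ` (`m ≥ 1`).
If a finitely generated `kG`-module `M` has no nonzero projective summand but its
restriction to `H` has a nonzero projective summand, then the restriction to `H` has an
indecomposable summand of dimension `pᵐ - 1 = |H| - 1`. -/
theorem restriction_with_projective_summand_has_summand_of_dimension_card_sub_one
    (p n m : ℕ) (hp : p.Prime) (hn : 1 ≤ n) (hm : 1 ≤ m) (hmn : m ≤ n)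
    (k : Type) [Field k] [CharP k p]
    (G : Type) [Group G] [Fintype G] (hcyc : IsCyclic G) (hcard : Fintype.card G = p ^ n)
    (H : Subgroup G) (hH : Nat.card H = p ^ m)
    (M : Type) [AddCommGroup M] [Module k M] [FiniteDimensional k M]
    (ρ : Representation k G M)
    (hnoproj : ¬ ∃ (P : Type) (_ : AddCommGroup P) (_ : Module k P)
      (ρP : Representation k G P), Nontrivial P ∧
      Module.Projective (MonoidAlgebra k G) ρP.asModule ∧ IsDirectSummandRep ρP ρ)
    (hres : ∃ (Q : Type) (_ : AddCommGroup Q) (_ : Module k Q)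
      (ρQ : Representation k (↥H) Q), Nontrivial Q ∧
      Module.Projective (MonoidAlgebra k ↥H) ρQ.asModule ∧
      IsDirectSummandRep ρQ (ρ.comp H.subtype)) :
    ∃ (U : Type) (_ : AddCommGroup U) (_ : Module k U)
      (ρU : Representation k (↥H) U),
      IndecomposableRep ρU ∧ IsDirectSummandRep ρU (ρ.comp H.subtype) ∧
      Module.finrank k U = p ^ m - 1 := by
  obtain ⟨g, h, hg, hh, hog, hoh, hhg⟩ := exists_generator_pow hp hmn hcard H hH
  have hpos (e : ℕ) : 0 < p ^ e := Nat.pos_of_ne_zero (pow_ne_zero _ hp.ne_zero)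
  set q := p ^ (n - m) with hq
  set T : Module.End k M := ρ g - 1 with hT
  have hS : (ρ.comp H.subtype) h - 1 = T ^ q := by
    rw [hT, hq, sub_one_pow_char_pow (k := k) hp, ← map_pow, ← hhg]
    rfl
  have hpn : p ^ n = q * p ^ m := by rw [hq, ← pow_add, Nat.sub_add_cancel hmn]
  have hTn : T ^ p ^ n = 0 := by
    rw [hT, sub_one_pow_char_pow (k := k) hp, ← map_pow, ← hog, pow_orderOf_eq_one, map_one,
      sub_self]
  have hTn' : T ^ (p ^ n - 1) = 0 := by
    by_contra hne
    obtain ⟨w, hw⟩ : ∃ w, (T ^ (p ^ n - 1)) w ≠ 0 := by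
      by_contra! hall
      exact hne (LinearMap.ext hall)
    obtain ⟨φ, hφ⟩ := not_forall.mp (mt (Module.forall_dual_apply_eq_zero_iff k _).mp hw)
    have hl : p ^ n - 1 + 1 = p ^ n := Nat.sub_add_cancel (hpos n)
    obtain ⟨U, hU, ψ, u, hsum, hfin, hψ, hu⟩ := exists_isDirectSummandRep ρ hg φ (p ^ n - 1) w
      (by rw [hl, ← hT, hTn]; simp) hφ (by rw [hl, ← hT, hTn]; simp)
    exact hnoproj ⟨U, inferInstance, inferInstance, ρ.subrepresentation U hU,
      Module.nontrivial_of_finrank_pos (R := k) (by omega),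
      projective_asModule_of_finrank_eq _ g ψ _ u hψ hu hfin (by rw [hcard, hl]), hsum⟩
  have hSN : T ^ (q * (p ^ m - 1)) ≠ 0 := by
    obtain ⟨Q, _, _, ρQ, _, hproj, i, r, hi, -, hri⟩ := hres
    intro h0
    refine sub_one_pow_ne_zero_of_projective ρQ hp h hh m hoh (LinearMap.ext fun x => ?_)
    have hinj : Function.Injective i := Function.LeftInverse.injective (LinearMap.congr_fun hri)
    apply hinj
    rw [hi.sub_one_pow_apply, hS, ← pow_mul, h0]
    simp
  obtain ⟨l, hl⟩ : ∃ l, p ^ m = l + 2 :=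
    ⟨p ^ m - 2, by have := Nat.one_lt_pow (by omega : m ≠ 0) hp.one_lt; omega⟩
  rw [hl, show l + 2 - 1 = l + 1 from rfl] at hSN
  rw [hl] at hpn ⊢
  have hqpos : 0 < q := hpos _
  have hex : ∃ d, T ^ d = 0 := ⟨_, hTn⟩
  classical
  let d := Nat.find hex
  have hd : T ^ d = 0 := Nat.find_spec hex
  have hd_gt : q * (l + 1) < d := by
    by_contra! hle
    exact hSN (pow_eq_zero_of_le hle hd)
  have hd_le : d ≤ p ^ n - 1 := Nat.find_min' hex hTn'
  have hd_pred : T ^ (d - 1) ≠ 0 := Nat.find_min hex (by omega)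
  obtain ⟨v, hv⟩ : ∃ v, (T ^ (d - 1)) v ≠ 0 := by
    by_contra! hall
    exact hd_pred (LinearMap.ext hall)
  have hexp₁ : q * (l + 1) = q * l + q := Nat.mul_succ q l
  have hexp₂ : q * (l + 2) = q * (l + 1) + q := Nat.mul_succ q (l + 1)
  have hnotMem : ((T ^ q) ^ l) ((T ^ (q - 1)) v) ∉ LinearMap.range ((T ^ q) ^ (l + 1)) := by
    rintro ⟨x, hx⟩
    rw [← Module.End.mul_apply, ← pow_mul, ← pow_mul, ← pow_add] at hx
    apply hv
    have e₁ : d - 1 = (d - q * (l + 1)) + (q * l + (q - 1)) := by omega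
    rw [e₁, pow_add, Module.End.mul_apply, ← hx, ← Module.End.mul_apply, ← pow_add,
      Nat.sub_add_cancel hd_gt.le, hd, LinearMap.zero_apply]
  obtain ⟨φ, hφ, hker⟩ := Submodule.exists_le_ker_of_notMem hnotMem
  obtain ⟨U, hU, ψ, u, hsum, hfin, hψ, hu⟩ := exists_isDirectSummandRep (ρ.comp H.subtype) hh φ l
    ((T ^ (q - 1)) v) (fun x => by rw [hS]; exact hker ⟨x, rfl⟩) (by rw [hS]; exact hφ) (by
      rw [hS, ← Module.End.mul_apply, ← pow_mul, ← pow_add,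
        pow_eq_zero_of_le (by omega) hd, LinearMap.zero_apply])
  exact ⟨U, inferInstance, inferInstance, Representation.subrepresentation (ρ.comp H.subtype) U hU,
    indecomposableRep_of_finrank_eq _ hh ψ l u hψ hu hfin, hsum, hfin⟩
end

section
/- Let k be a field of characteristic p > 0, G a finite group, and N a normal subgroup of G whose order is divisible by p. Let M and M' be finitely generated kG-modules on which N acts trivially (every element of N acts as the identity). If a kG-linear map f: M → M' factors through a projective kG-module, then f = 0. Consequently, the inflation functor from finitely generated k(G/N)-modules to the stable module category of kG is faithful. -/
open TensorProduct

section Defs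

variable {k G : Type} [Field k] [Group G]

/-- A `kG`-linear map is stably trivial if it factors through a projective
`kG`-module (equivariantly). -/
def StablyTrivial {V W : Type} [AddCommGroup V] [Module k V] [AddCommGroup W] [Module k W]
    (ρV : Representation k G V) (ρW : Representation k G W) (f : V →ₗ[k] W) : Prop :=
  ∃ (P : Type) (_ : AddCommGroup P) (_ : Module k P) (ρP : Representation k G P),
    Module.Projective (MonoidAlgebra k G) ρP.asModule ∧
    ∃ (a : V →ₗ[k] P) (b : P →ₗ[k] W),
      Equivariant ρV ρP a ∧ Equivariant ρP ρW b ∧ f = b ∘ₗ a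

/-- A `kG`-linear map is a stable isomorphism if it is invertible up to
stably trivial maps. -/
def StableIso {V W : Type} [AddCommGroup V] [Module k V] [AddCommGroup W] [Module k W]
    (ρV : Representation k G V) (ρW : Representation k G W) (f : V →ₗ[k] W) : Prop :=
  Equivariant ρV ρW f ∧ ∃ ψ : W →ₗ[k] V, Equivariant ρW ρV ψ ∧
    StablyTrivial ρV ρV (ψ ∘ₗ f - LinearMap.id) ∧
    StablyTrivial ρW ρW (f ∘ₗ ψ - LinearMap.id)

end Defs

/-- A function on a finite group that is invariant under left translation by a subgroup whose
order is divisible by the characteristic sums to zero. -/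
theorem sum_eq_zero_of_mul_left_invariant (p : ℕ) {k G V : Type*} [Field k] [CharP k p]
    [Group G] [Fintype G] [AddCommGroup V] [Module k V] (N : Subgroup G) (hdvd : p ∣ Nat.card N)
    (F : G → V) (hF : ∀ n ∈ N, ∀ g, F (n * g) = F g) : ∑ g, F g = 0 := by
  classical
  have hcard : (Nat.card N : k) = 0 := (CharP.cast_eq_zero_iff k p _).2 hdvd
  have key : ∀ q : G ⧸ N, ∑ g : {g : G // (g : G ⧸ N) = q}, F (g : G)⁻¹ = 0 := by
    intro q
    induction q using QuotientGroup.induction_on with | _ x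
    have hconst : ∀ g : {g : G // (g : G ⧸ N) = x}, F (g : G)⁻¹ = F x⁻¹ := by
      rintro ⟨g, hg⟩
      simpa using hF (g⁻¹ * x) (QuotientGroup.eq.1 hg) x⁻¹
    have hfiber : Nat.card {g : G // (g : G ⧸ N) = x} = Nat.card N := by
      refine (Nat.card_congr
        (QuotientGroup.preimageMkEquivSubgroupProdSet N {(x : G ⧸ N)})).trans ?_
      simp
    rw [Finset.sum_congr rfl fun g _ => hconst g, Finset.sum_const, Finset.card_univ,
      ← Nat.card_eq_fintype_card, hfiber, ← Nat.cast_smul_eq_nsmul k, hcard, zero_smul]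
  calc ∑ g, F g = ∑ g, F g⁻¹ := (Equiv.sum_comp (Equiv.inv G) F).symm
    _ = ∑ q : G ⧸ N, ∑ g : {g : G // (g : G ⧸ N) = q}, F (g : G)⁻¹ :=
      (Fintype.sum_fiberwise (fun g : G => (g : G ⧸ N)) fun g => F g⁻¹).symm
    _ = 0 := Finset.sum_eq_zero fun q _ => key q

theorem asAlgebraHom_eq_sum {k G V : Type*} [Field k] [Group G] [Fintype G]
    [AddCommGroup V] [Module k V] (ρ : Representation k G V) (c : MonoidAlgebra k G) :
    ρ.asAlgebraHom c = ∑ g, c.coeff g • ρ g := by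
  rw [Representation.asAlgebraHom_def, MonoidAlgebra.lift_apply]
  exact Finsupp.sum_fintype _ _ (by simp)

/-- Let `N` act trivially through `ρ`. An element of `k[G]` fixed by left multiplication by `N`
acts as zero if the order of `N` is divisible by the characteristic. -/
theorem asAlgebraHom_eq_zero_of_mul_left_invariant (p : ℕ) {k G V : Type*} [Field k] [CharP k p]
    [Group G] [Fintype G] [AddCommGroup V] [Module k V] (N : Subgroup G) (hdvd : p ∣ Nat.card N)
    (ρ : Representation k G V) (hρ : ∀ n ∈ N, ρ n = LinearMap.id) (c : MonoidAlgebra k G)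
    (hc : ∀ n ∈ N, MonoidAlgebra.of k G n * c = c) : ρ.asAlgebraHom c = 0 := by
  rw [asAlgebraHom_eq_sum]
  refine sum_eq_zero_of_mul_left_invariant (k := k) p N hdvd _ fun n hn g => ?_
  have hcoeff : c.coeff (n * g) = c.coeff g := by
    conv_lhs => rw [← hc n hn]
    simp [MonoidAlgebra.of_apply, MonoidAlgebra.coeff_single_mul_apply]
  rw [hcoeff, map_mul, hρ n hn]
  rfl

theorem Equivariant.map_asAlgebraHom {k G V W : Type} [Field k] [Group G] [Fintype G]
    [AddCommGroup V] [Module k V] [AddCommGroup W] [Module k W]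
    {ρV : Representation k G V} {ρW : Representation k G W} {f : V →ₗ[k] W}
    (hf : Equivariant ρV ρW f) (c : MonoidAlgebra k G) (v : V) :
    f (ρV.asAlgebraHom c v) = ρW.asAlgebraHom c (f v) := by
  have h : ∀ g, f (ρV g v) = ρW g (f v) := fun g => LinearMap.congr_fun (hf g) v
  simp [asAlgebraHom_eq_sum, LinearMap.sum_apply, h]

/-- An equivariant map from a projective module to a module on which `N` acts trivially kills the
`N`-fixed vectors, if the order of `N` is divisible by the characteristic. -/
theorem Equivariant.map_eq_zero_of_projective (p : ℕ) {k G P W : Type} [Field k] [CharP k p]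
    [Group G] [Fintype G] [AddCommGroup P] [Module k P] [AddCommGroup W] [Module k W]
    (N : Subgroup G) (hdvd : p ∣ Nat.card N)
    {ρP : Representation k G P} {ρW : Representation k G W} {b : P →ₗ[k] W}
    (hb : Equivariant ρP ρW b) (hP : Module.Projective (MonoidAlgebra k G) ρP.asModule)
    (hW : ∀ n ∈ N, ρW n = LinearMap.id) (x : P) (hx : ∀ n ∈ N, ρP n x = x) : b x = 0 := by
  obtain ⟨s, hs⟩ := Module.projective_def.1 hP
  set y : ρP.asModule := ρP.asModuleEquiv.symm x
  have hfix : ∀ v, ∀ n ∈ N, MonoidAlgebra.of k G n * s y v = s y v := by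
    intro v n hn
    rw [← smul_eq_mul, ← Finsupp.smul_apply, ← map_smul,
      ← Representation.asModuleEquiv_symm_map_rho, hx n hn]
  have hxsum : x = (s y).sum fun v c => ρP.asAlgebraHom c (ρP.asModuleEquiv v) := by
    conv_lhs => rw [← ρP.asModuleEquiv.apply_symm_apply x, ← hs (ρP.asModuleEquiv.symm x)]
    simp [Finsupp.linearCombination_apply, Finsupp.sum, y,
      Representation.asModuleEquiv_map_smul]
  rw [hxsum, Finsupp.sum, map_sum]
  refine Finset.sum_eq_zero fun v _ => ?_
  rw [hb.map_asAlgebraHom, asAlgebraHom_eq_zero_of_mul_left_invariant p N hdvd ρW hW _ (hfix v),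
    LinearMap.zero_apply]

/-- If `N ⊲ G` has order divisible by `p` and `M`, `M'` are `kG`-modules on which `N`
acts trivially (i.e. inflated from `G/N`), then any `kG`-linear map `M → M'` factoring
through a projective `kG`-module is zero. (Hence inflation
`k(G/N)-mod → kG-stab` is faithful.) -/
theorem map_between_inflated_modules_factoring_through_projective_is_zero
    (p : ℕ) (hp : p.Prime) (k : Type) [Field k] [CharP k p]
    (G : Type) [Group G] [Fintype G]
    (N : Subgroup G) (hNnormal : N.Normal) (hdvd : p ∣ Nat.card N)
    (M M' : Type) [AddCommGroup M] [Module k M] [FiniteDimensional k M]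
    [AddCommGroup M'] [Module k M'] [FiniteDimensional k M']
    (ρ : Representation k G M) (ρ' : Representation k G M')
    (hM : ∀ g ∈ N, ρ g = LinearMap.id) (hM' : ∀ g ∈ N, ρ' g = LinearMap.id)
    (f : M →ₗ[k] M') (hf : Equivariant ρ ρ' f)
    (hstab : StablyTrivial ρ ρ' f) :
    f = 0 := by
  obtain ⟨P, _, _, ρP, hP, a, b, ha, hb, rfl⟩ := hstab
  ext m
  refine hb.map_eq_zero_of_projective p N hdvd hP hM' (a m) fun n hn => ?_
  have h := LinearMap.congr_fun (ha n) m
  rw [hM n hn] at h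
  exact h.symm
end
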